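/- Let E be a centrally orthocomplete pseudo-effect algebra and K ⊆ E a type-determining set. Then there exist unique pairwise orthogonal central elements c₁, c₂, c₃ ∈ Γ(E) with c₁ + c₂ + c₃ = 1 such that c₁ is type-K, c₂ is locally type-K but properly non-K, and c₃ is purely non-K; moreover c₁ = c_{K∩γK}, c₂ = c_K ∧ (c_{K∩γK})', c₃ = (c_K)', and one has K ∩ γK = Γ(E)[0,c₁], K ⊆ E[0,c₁+c₂], and Γ(E)[0,c₂+c₃] ∩ K = {0}. -/

import Mathlib

namespace PEApaper

/-- The bare data of a partial-addition structure: a partial binary operation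
(encoded via `Option`) together with constants `0` and `1`. -/
structure PartialStruct (E : Type) where
  padd : E → E → Option E
  zero : E
  one : E

namespace PartialStruct

variable {E : Type}

/-- `a ≤ b` iff `a + c = b` for some `c`. -/
def le (P : PartialStruct E) (a b : E) : Prop := ∃ c, P.padd a c = some b

/-- `m` is the greatest lower bound (meet `a ∧ b`) of `a` and `b`. -/
def IsMeet (P : PartialStruct E) (a b m : E) : Prop :=
  P.le m a ∧ P.le m b ∧ ∀ x, P.le x a → P.le x b → P.le x m

/-- `j` is the least upper bound (join `a ∨ b`) of `a` and `b`. -/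
def IsJoin (P : PartialStruct E) (a b j : E) : Prop :=
  P.le a j ∧ P.le b j ∧ ∀ x, P.le a x → P.le b x → P.le j x

/-- `s` is the supremum of the set `S`. -/
def IsSup (P : PartialStruct E) (S : Set E) (s : E) : Prop :=
  (∀ x ∈ S, P.le x s) ∧ ∀ u, (∀ x ∈ S, P.le x u) → P.le s u

/-- Left-associated partial sum of a list, continuing from `acc`. -/
def IsSumFrom (P : PartialStruct E) : E → List E → E → Prop
  | acc, [], s => s = acc
  | acc, a :: l, s => ∃ t, P.padd acc a = some t ∧ IsSumFrom P t l s

/-- `s` is the (left-associated) orthosum `e₁ + e₂ + ⋯ + eₙ` of the list. -/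
def IsSumList (P : PartialStruct E) (l : List E) (s : E) : Prop :=
  match l with
  | [] => s = P.zero
  | a :: t => IsSumFrom P a t s

/-- `c` is a central element: there is a PEA-isomorphism
`f : E → E[0,c] × E[0,c∼]` with `f c = (c,0)` such that `f x = (x₁,x₂)`
implies `x = x₁ + x₂`.  The isomorphism onto the product of the two
interval pseudo-effect algebras is spelled out explicitly. -/
def IsCentral (P : PartialStruct E) (c : E) : Prop :=
  ∃ cs, P.padd c cs = some P.one ∧
    ∃ f : E → E × E,
      (∀ x, P.le (f x).1 c ∧ P.le (f x).2 cs) ∧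
      Function.Injective f ∧
      (∀ y : E × E, P.le y.1 c → P.le y.2 cs → ∃ x, f x = y) ∧
      f c = (c, P.zero) ∧
      f P.one = (c, cs) ∧
      (∀ x, P.padd (f x).1 (f x).2 = some x) ∧
      (∀ a b ab, P.padd a b = some ab →
        P.padd (f a).1 (f b).1 = some (f ab).1 ∧
        P.padd (f a).2 (f b).2 = some (f ab).2) ∧
      (∀ a b s t, P.padd (f a).1 (f b).1 = some s → P.le s c →
        P.padd (f a).2 (f b).2 = some t → P.le t cs →
        ∃ ab, P.padd a b = some ab)

/-- The center `Γ(E)`. -/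
def center (P : PartialStruct E) : Set E := {c | P.IsCentral c}

/-- The central interval `Γ(E)[0,c] = Γ(E) ∩ E[0,c]`. -/
def centerIntervalSet (P : PartialStruct E) (c : E) : Set E :=
  {x | P.IsCentral x ∧ P.le x c}

/-- A Γ-orthogonal family: one dominated elementwise by a pairwise
disjoint family of central elements. -/
def GammaOrthogonal (P : PartialStruct E) {I : Type} (e : I → E) : Prop :=
  ∃ c : I → E, (∀ i, P.IsCentral (c i)) ∧
    (∀ i j, i ≠ j → P.IsMeet (c i) (c j) P.zero) ∧
    ∀ i, P.le (e i) (c i)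

/-- Centrally orthocomplete: every Γ-orthogonal family has a supremum. -/
def IsCOPEA (P : PartialStruct E) : Prop :=
  ∀ (I : Type) (e : I → E), P.GammaOrthogonal e → ∃ s, P.IsSup (Set.range e) s

/-- `c` is the central cover of `e`: the smallest central element above `e`. -/
def IsCentralCover (P : PartialStruct E) (c e : E) : Prop :=
  P.IsCentral c ∧ P.le e c ∧ ∀ d, P.IsCentral d → P.le e d → P.le c d

/-- `[Q]`: the set of all suprema of Γ-orthogonal families of elements of `Q`. -/
def bra (P : PartialStruct E) (Q : Set E) : Set E :=
  {s | ∃ (I : Type) (e : I → E), (∀ i, e i ∈ Q) ∧ P.GammaOrthogonal e ∧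
    P.IsSup (Set.range e) s}

/-- `Q^γ = {q ∧ c : q ∈ Q, c ∈ Γ(E)}`. -/
def gammaClosure (P : PartialStruct E) (Q : Set E) : Set E :=
  {m | ∃ q ∈ Q, ∃ c, P.IsCentral c ∧ P.IsMeet q c m}

/-- `Q↓ = ⋃_{q ∈ Q} E[0,q]`. -/
def downSet (P : PartialStruct E) (Q : Set E) : Set E :=
  {e | ∃ q ∈ Q, P.le e q}

/-- `Q' = {e ∈ E : q ∧ e = 0 for all q ∈ Q}`. -/
def commutant (P : PartialStruct E) (Q : Set E) : Set E :=
  {e | ∀ q ∈ Q, P.IsMeet q e P.zero}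

/-- A type-determining (TD) set: `K = [K] = K^γ`. -/
def IsTD (P : PartialStruct E) (K : Set E) : Prop :=
  P.bra K = K ∧ P.gammaClosure K = K

/-- A strongly type-determining (STD) set: `K = [K] = K↓`. -/
def IsSTD (P : PartialStruct E) (K : Set E) : Prop :=
  P.bra K = K ∧ P.downSet K = K

/-- `c` is the type-cover of `K` (w.r.t. the central cover map `γ`):
the unique central element with `γK = Γ(E)[0,c]`. -/
def IsTypeCover (P : PartialStruct E) (γ : E → E) (K : Set E) (c : E) : Prop :=
  P.IsCentral c ∧ γ '' K = P.centerIntervalSet c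

/-- An atom: a nonzero element with no proper nonzero subelement. -/
def IsAtom' (P : PartialStruct E) (a : E) : Prop :=
  a ≠ P.zero ∧ ∀ x, P.le x a → x = P.zero ∨ x = a

end PartialStruct

/-- A PEA-isomorphism between two partial-addition structures: a bijective
morphism whose inverse is a morphism. -/
structure IsPEAIso {A B : Type} (P : PartialStruct A) (Q : PartialStruct B)
    (f : A → B) : Prop where
  bijective : Function.Bijective f
  map_one : f P.one = Q.one
  map_add : ∀ a b ab, P.padd a b = some ab → Q.padd (f a) (f b) = some (f ab)
  rev_add : ∀ a b s, Q.padd (f a) (f b) = some s → ∃ ab, P.padd a b = some ab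

open scoped Classical in
/-- The (coordinatewise) product of a family of partial structures. -/
noncomputable def prodStruct {I : Type} {A : I → Type}
    (Ps : ∀ i, PartialStruct (A i)) : PartialStruct (∀ i, A i) where
  padd a b :=
    if h : ∀ i, ∃ s, (Ps i).padd (a i) (b i) = some s
    then some fun i => Classical.choose (h i)
    else none
  zero := fun i => (Ps i).zero
  one := fun i => (Ps i).one

/-- A pseudo-effect algebra. -/
structure PEA (E : Type) extends PartialStruct E where
  assoc_def : ∀ a b c : E,
    (∃ ab, padd a b = some ab ∧ ∃ x, padd ab c = some x) ↔
    (∃ bc, padd b c = some bc ∧ ∃ y, padd a bc = some y)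
  assoc_eq : ∀ a b c ab bc x y, padd a b = some ab → padd ab c = some x →
    padd b c = some bc → padd a bc = some y → x = y
  exu_right : ∀ a : E, ∃! d, padd a d = some one
  exu_left : ∀ a : E, ∃! e, padd e a = some one
  shift : ∀ a b ab, padd a b = some ab →
    (∃ d, padd d a = some ab) ∧ (∃ e, padd b e = some ab)
  one_add : ∀ a x, padd one a = some x → a = zero
  add_one : ∀ a x, padd a one = some x → a = zero

namespace PEA

variable {E : Type} (P : PEA E)

/-- Shorthand for the underlying partial structure. -/
abbrev ps : PartialStruct E := P.toPartialStruct

theorem one_add_zero : P.padd P.one P.zero = some P.one := by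
  obtain ⟨d, hd, -⟩ := P.exu_right P.one
  have h := P.one_add d P.one hd
  rwa [h] at hd

theorem zero_add_one : P.padd P.zero P.one = some P.one := by
  obtain ⟨e, he, -⟩ := P.exu_left P.one
  have h := P.add_one e P.one he
  rwa [h] at he

theorem padd_zero (a : E) : P.padd a P.zero = some a := by
  obtain ⟨e, he, -⟩ := P.exu_left a
  have h1 : ∃ ab, P.padd e a = some ab ∧ ∃ x, P.padd ab P.zero = some x :=
    ⟨P.one, he, P.one, P.one_add_zero⟩
  obtain ⟨t, ht, y, hy⟩ := (P.assoc_def e a P.zero).mp h1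
  have hxy : P.one = y :=
    P.assoc_eq e a P.zero P.one t P.one y he P.one_add_zero ht hy
  obtain ⟨d, hd, hu⟩ := P.exu_right e
  have hta : t = a := by
    have h2 : t = d := hu t (by rw [← hxy] at hy; exact hy)
    have h3 : a = d := hu a he
    rw [h2, h3]
  rwa [hta] at ht

theorem zero_padd (a : E) : P.padd P.zero a = some a := by
  obtain ⟨d, hd, -⟩ := P.exu_right a
  have h1 : ∃ bc, P.padd a d = some bc ∧ ∃ y, P.padd P.zero bc = some y :=
    ⟨P.one, hd, P.one, P.zero_add_one⟩
  obtain ⟨t, ht, y, hy⟩ := (P.assoc_def P.zero a d).mpr h1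
  have hxy : y = P.one :=
    P.assoc_eq P.zero a d t P.one y P.one ht hy hd P.zero_add_one
  obtain ⟨e, he, hu⟩ := P.exu_left d
  have hta : t = a := by
    have h2 : t = e := hu t (by rw [hxy] at hy; exact hy)
    have h3 : a = e := hu a hd
    rw [h2, h3]
  rwa [hta] at ht

theorem zero_le (a : E) : P.ps.le P.zero a := ⟨a, P.zero_padd a⟩

theorem le_refl (a : E) : P.ps.le a a := ⟨P.zero, P.padd_zero a⟩

open scoped Classical in
/-- The interval pseudo-effect algebra `E[0,p]` as a partial structure on
the subtype `{x // x ≤ p}`; the sum is defined iff it is defined in `E`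
and lies below `p`, and the unit is `p`. -/
noncomputable def intervalStruct (p : E) :
    PartialStruct {x : E // P.ps.le x p} where
  padd a b := (P.padd a.1 b.1).bind fun s =>
    if h : P.ps.le s p then some ⟨s, h⟩ else none
  zero := ⟨P.zero, P.zero_le p⟩
  one := ⟨p, P.le_refl p⟩

end PEA

/-- The order relation of a complete Boolean algebra structure, made explicit. -/
def cbaLe {X : Type} (inst : CompleteBooleanAlgebra X) (a b : X) : Prop :=
  @LE.le X (by letI := inst; exact inferInstance) a b

end PEApaper

namespace PEApaper

namespace PEA

variable {E : Type} (P : PEA E)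

theorem assoc_right {a b c ab x : E} (h₁ : P.padd a b = some ab) (h₂ : P.padd ab c = some x) :
    ∃ bc, P.padd b c = some bc ∧ P.padd a bc = some x := by
  obtain ⟨bc, hbc, y, hy⟩ := (P.assoc_def a b c).mp ⟨ab, h₁, x, h₂⟩
  obtain rfl := P.assoc_eq _ _ _ _ _ _ _ h₁ h₂ hbc hy
  exact ⟨bc, hbc, hy⟩

theorem assoc_left {a b c bc x : E} (h₁ : P.padd b c = some bc) (h₂ : P.padd a bc = some x) :
    ∃ ab, P.padd a b = some ab ∧ P.padd ab c = some x := by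
  obtain ⟨ab, hab, y, hy⟩ := (P.assoc_def a b c).mpr ⟨bc, h₁, x, h₂⟩
  obtain rfl := P.assoc_eq _ _ _ _ _ _ _ hab hy h₁ h₂
  exact ⟨ab, hab, hy⟩

theorem add_left_cancel {a b c x : E} (hb : P.padd a b = some x) (hc : P.padd a c = some x) :
    b = c := by
  obtain ⟨x', hx', -⟩ := P.exu_right x
  obtain ⟨u, hu, hau⟩ := P.assoc_right hb hx'
  obtain ⟨v, hv, hav⟩ := P.assoc_right hc hx'
  obtain rfl := (P.exu_right a).unique hau hav
  obtain ⟨w, hw, -⟩ := P.exu_right u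
  obtain ⟨r, hr, hbr⟩ := P.assoc_right hu hw
  obtain ⟨s, hs, hcs⟩ := P.assoc_right hv hw
  obtain rfl := Option.some.inj (hr.symm.trans hs)
  exact (P.exu_left r).unique hbr hcs

theorem eq_zero_of_add_eq_zero {a b : E} (h : P.padd a b = some P.zero) : a = P.zero := by
  obtain ⟨x, hx, -⟩ := P.assoc_left h P.one_add_zero
  exact P.one_add a x hx

theorem le_trans {a b c : E} (hab : P.ps.le a b) (hbc : P.ps.le b c) : P.ps.le a c := by
  obtain ⟨x, hx⟩ := hab
  obtain ⟨y, hy⟩ := hbc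
  obtain ⟨z, -, hz⟩ := P.assoc_right hx hy
  exact ⟨z, hz⟩

theorem le_antisymm {a b : E} (hab : P.ps.le a b) (hba : P.ps.le b a) : a = b := by
  obtain ⟨x, hx⟩ := hab
  obtain ⟨y, hy⟩ := hba
  obtain ⟨z, hz, haz⟩ := P.assoc_right hx hy
  obtain rfl := P.add_left_cancel haz (P.padd_zero a)
  obtain rfl := P.eq_zero_of_add_eq_zero hz
  exact Option.some.inj ((P.padd_zero a).symm.trans hx)

theorem eq_zero_of_le_zero {a : E} (h : P.ps.le a P.zero) : a = P.zero :=
  P.le_antisymm h (P.zero_le a)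

theorem le_one (x : E) : P.ps.le x P.one := (P.exu_right x).exists

/-- A direct decomposition of `E`, given by its two coordinate projections
viewed as self-maps of `E`. -/
structure Splitting (p q : E → E) : Prop where
  map_add : ∀ {a b x}, P.padd a b = some x → P.padd (p a) (p b) = some (p x)
  sum : ∀ x, P.padd (p x) (q x) = some x
  map_compl : ∀ x, p (q x) = P.zero
  comm : ∀ x y, ∃ s, P.padd (p x) (q y) = some s ∧ P.padd (q y) (p x) = some s

namespace Splitting

variable {P} {p q p' q' : E → E}

theorem idem (h : P.Splitting p q) (x : E) : p (p x) = p x := by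
  have h₁ := h.map_add (h.sum x)
  rw [h.map_compl, P.padd_zero] at h₁
  exact Option.some.inj h₁

theorem compl_map (h : P.Splitting p q) (x : E) : q (p x) = P.zero := by
  have h₁ := h.sum (p x)
  rw [h.idem] at h₁
  exact P.add_left_cancel h₁ (P.padd_zero _)

theorem sum_swap (h : P.Splitting p q) (x : E) : P.padd (q x) (p x) = some x := by
  obtain ⟨s, hs, hs'⟩ := h.comm x x
  exact hs'.trans (hs.symm.trans (h.sum x))

theorem compl_add (h : P.Splitting p q) {a b x : E} (hab : P.padd a b = some x) :
    P.padd (q a) (q b) = some (q x) := by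
  obtain ⟨u, hu, hau⟩ := P.assoc_right (h.sum a) hab
  obtain ⟨v, hv, hvu⟩ := P.assoc_left (h.sum b) hu
  obtain ⟨s, hs, hs'⟩ := h.comm b a
  obtain rfl := Option.some.inj (hs'.symm.trans hv)
  obtain ⟨w, hw, hbw⟩ := P.assoc_right hs hvu
  obtain ⟨z, hz, hzw⟩ := P.assoc_left hbw hau
  obtain rfl := Option.some.inj (hz.symm.trans (h.map_add hab))
  rw [hw, P.add_left_cancel hzw (h.sum x)]

theorem swap (h : P.Splitting p q) : P.Splitting q p where
  map_add := h.compl_add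
  sum := h.sum_swap
  map_compl := h.compl_map
  comm x y := (h.comm y x).imp fun _ hs => hs.symm

theorem map_le (h : P.Splitting p q) (x : E) : P.ps.le (p x) x := ⟨q x, h.sum x⟩

theorem mono (h : P.Splitting p q) {x y : E} (hxy : P.ps.le x y) : P.ps.le (p x) (p y) := by
  obtain ⟨z, hz⟩ := hxy
  exact ⟨p z, h.map_add hz⟩

theorem map_eq_zero_of_le (h : P.Splitting p q) {x u : E} (hx : P.ps.le x (q u)) :
    p x = P.zero := by
  have h₁ := h.mono hx
  rw [h.map_compl] at h₁
  exact P.eq_zero_of_le_zero h₁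

theorem map_eq_self_of_le (h : P.Splitting p q) {x u : E} (hx : P.ps.le x (p u)) :
    p x = x := by
  have h₁ := h.sum x
  rw [h.swap.map_eq_zero_of_le hx, P.padd_zero] at h₁
  exact Option.some.inj h₁

theorem eq_zero_of_le_of_le (h : P.Splitting p q) {x u v : E} (hu : P.ps.le x (p u))
    (hv : P.ps.le x (q v)) : x = P.zero :=
  (h.map_eq_self_of_le hu).symm.trans (h.map_eq_zero_of_le hv)

theorem isMeet (h : P.Splitting p q) (x : E) : P.ps.IsMeet x (p P.one) (p x) := by
  refine ⟨h.map_le x, h.mono (P.le_one x), fun z hz hz₁ => ?_⟩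
  have h₁ := h.mono hz
  rwa [h.map_eq_self_of_le hz₁] at h₁

theorem isMeet_zero (h : P.Splitting p q) {x y u v : E} (hx : P.ps.le x (p u))
    (hy : P.ps.le y (q v)) : P.ps.IsMeet x y P.ps.zero := by
  refine ⟨P.zero_le _, P.zero_le _, fun z hzx hzy => ?_⟩
  rw [h.eq_zero_of_le_of_le (P.le_trans hzx hx) (P.le_trans hzy hy)]
  exact P.le_refl _

theorem isCentral (h : P.Splitting p q) : P.ps.IsCentral (p P.one) := by
  refine ⟨q P.one, h.sum _, fun x => (p x, q x), fun x => ⟨h.mono (P.le_one x),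
    h.swap.mono (P.le_one x)⟩, ?_, ?_, ?_, rfl, h.sum, fun a b ab hab =>
      ⟨h.map_add hab, h.compl_add hab⟩, ?_⟩
  · intro x y hxy
    have h₁ : p x = p y := congrArg Prod.fst hxy
    have h₂ : q x = q y := congrArg Prod.snd hxy
    have h₃ := h.sum x
    rw [h₁, h₂, h.sum y] at h₃
    exact (Option.some.inj h₃).symm
  · rintro ⟨y, z⟩ hy hz
    obtain ⟨s, hs, -⟩ := h.comm y z
    rw [h.map_eq_self_of_le hy, h.swap.map_eq_self_of_le hz] at hs
    have h₁ := h.map_add hs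
    have h₂ := h.compl_add hs
    rw [h.map_eq_self_of_le hy, h.map_eq_zero_of_le hz, P.padd_zero] at h₁
    rw [h.swap.map_eq_self_of_le hz, h.swap.map_eq_zero_of_le hy, P.zero_padd] at h₂
    exact ⟨s, Prod.ext (Option.some.inj h₁).symm (Option.some.inj h₂).symm⟩
  · exact Prod.ext (h.idem _) (h.compl_map _)
  · intro a b s t hs hsc ht htc
    obtain ⟨r, hr, -⟩ := h.comm s t
    rw [h.map_eq_self_of_le hsc, h.swap.map_eq_self_of_le htc] at hr
    obtain ⟨u, hu, hau⟩ := P.assoc_right hs hr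
    obtain ⟨v, hv, hvu⟩ := P.assoc_left ht hu
    obtain ⟨w, hw, hw'⟩ := h.comm b a
    obtain rfl := Option.some.inj (hw.symm.trans hv)
    obtain ⟨y, hy, hay⟩ := P.assoc_right hw' hvu
    obtain rfl := Option.some.inj (hy.symm.trans (h.sum b))
    obtain ⟨z, hz, hzb⟩ := P.assoc_left hay hau
    obtain rfl := Option.some.inj (hz.symm.trans (h.sum a))
    exact ⟨r, hzb⟩

theorem exists_comp (h : P.Splitting p q) (h' : P.Splitting p' q') :
    ∃ r, P.Splitting (fun x => p (p' x)) r := by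
  have key : ∀ x, ∃ r, P.padd (q (p' x)) (q' x) = some r := fun x => by
    obtain ⟨s, hs, -⟩ := P.assoc_right (h.sum (p' x)) (h'.sum x)
    exact ⟨s, hs⟩
  choose r hr using key
  have hq : ∀ x, p' (q (p' x)) = q (p' x) := fun x =>
    h'.map_eq_self_of_le (h.swap.map_le (p' x))
  have hp : ∀ x, p' (p (p' x)) = p (p' x) := fun x =>
    h'.map_eq_self_of_le (h.map_le (p' x))
  refine ⟨r, fun hab => h.map_add (h'.map_add hab), fun x => ?_, fun x => ?_, fun x y => ?_⟩
  · obtain ⟨s, hs, hs'⟩ := P.assoc_right (h.sum (p' x)) (h'.sum x)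
    rwa [Option.some.inj ((hr x).symm.trans hs)]
  · have h₁ := h'.map_add (hr x)
    rw [h'.map_compl, P.padd_zero, hq] at h₁
    change p (p' (r x)) = _
    rw [← Option.some.inj h₁, h.map_compl]
  · obtain ⟨s, hs, hs'⟩ := h.comm (p' x) (p' y)
    have hps : p' s = s := by
      have h₁ := h'.map_add hs
      rw [hp, hq, hs] at h₁
      exact (Option.some.inj h₁).symm
    obtain ⟨t, ht, ht'⟩ := h'.comm s y
    rw [hps] at ht ht'
    obtain ⟨u, hu, hxu⟩ := P.assoc_right hs ht
    obtain rfl := Option.some.inj (hu.symm.trans (hr y))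
    refine ⟨t, hxu, ?_⟩
    obtain ⟨v, hv, hyv⟩ := P.assoc_right hs' ht
    obtain ⟨w, hw, hw'⟩ := h'.comm (p (p' x)) y
    rw [hp] at hw hw'
    obtain rfl := Option.some.inj (hw.symm.trans hv)
    obtain ⟨z, hz, hzx⟩ := P.assoc_left hw' hyv
    obtain rfl := Option.some.inj (hz.symm.trans (hr y))
    exact hzx

end Splitting

theorem splitting_zero_id : P.Splitting (fun _ => P.zero) id where
  map_add _ := P.padd_zero _
  sum := P.zero_padd
  map_compl _ := rfl
  comm _ y := ⟨y, P.zero_padd y, P.padd_zero y⟩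

theorem exists_splitting_of_isCentral {c : E} (hc : P.ps.IsCentral c) :
    ∃ p q, P.Splitting p q ∧ p P.one = c := by
  obtain ⟨cs, -, f, hle, hinj, hsurj, -, h1, hsum, hadd, hdef⟩ := hc
  have left : ∀ x, P.ps.le x c → f x = (x, P.zero) := fun x hx => by
    obtain ⟨y, hy⟩ := hsurj (x, P.zero) hx (P.zero_le _)
    have h₁ := hsum y
    rw [hy, P.padd_zero] at h₁
    rwa [← Option.some.inj h₁] at hy
  have right : ∀ x, P.ps.le x cs → f x = (P.zero, x) := fun x hx => by
    obtain ⟨y, hy⟩ := hsurj (P.zero, x) (P.zero_le _) hx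
    have h₁ := hsum y
    rw [hy, P.zero_padd] at h₁
    rwa [← Option.some.inj h₁] at hy
  refine ⟨fun x => (f x).1, fun x => (f x).2, ⟨fun hab => (hadd _ _ _ hab).1, hsum, fun x => ?_,
    fun x y => ?_⟩, ?_⟩
  · simp only [right _ (hle x).2]
  · have hx := left _ (hle x).1
    have hy := right _ (hle y).2
    obtain ⟨s, hs⟩ := hdef (f x).1 (f y).2 (f x).1 (f y).2
      (by rw [hx, hy]; exact P.padd_zero _) (hle x).1
      (by rw [hx, hy]; exact P.zero_padd _) (hle y).2
    obtain ⟨t, ht⟩ := hdef (f y).2 (f x).1 (f x).1 (f y).2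
      (by rw [hx, hy]; exact P.zero_padd _) (hle x).1
      (by rw [hx, hy]; exact P.padd_zero _) (hle y).2
    have hs' := hadd _ _ _ hs
    have ht' := hadd _ _ _ ht
    simp only [hx, hy, ps, P.padd_zero, P.zero_padd, Option.some.injEq] at hs' ht'
    have hst : s = t := hinj (Prod.ext (hs'.1.symm.trans ht'.1) (hs'.2.symm.trans ht'.2))
    exact ⟨s, hs, hst ▸ ht⟩
  · simp only [show f P.one = (c, cs) from h1]

theorem centralCover_eq_self {γ : E → E} (hγ : ∀ e, P.ps.IsCentralCover (γ e) e) {x : E}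
    (hx : P.ps.IsCentral x) : γ x = x :=
  P.le_antisymm ((hγ x).2.2 x hx (P.le_refl x)) (hγ x).2.1

end PEA

end PEApaper

open PEApaper PEApaper.PartialStruct in
/-- Theorem 5.9: in a COPEA, for a TD set `K` there exist unique pairwise
orthogonal central `c₁, c₂, c₃` with `c₁ + c₂ + c₃ = 1` such that `c₁` is
type-`K`, `c₂` is locally type-`K` but properly non-`K`, and `c₃` is purely
non-`K`.  Moreover `c₁ = c_{K∩γK}`, `c₂ = c_K ∧ (c_{K∩γK})'`, `c₃ = (c_K)'`,
`K ∩ γK = Γ(E)[0,c₁]`, `K ⊆ E[0,c₁+c₂]`, and `Γ(E)[0,c₂+c₃] ∩ K = {0}`. -/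
theorem stmt16 {E : Type} (P : PEA E) (hco : P.ps.IsCOPEA)
    (γ : E → E) (hγ : ∀ e, P.ps.IsCentralCover (γ e) e)
    (K : Set E) (hK : P.ps.IsTD K)
    (cK : E) (hcK : P.ps.IsTypeCover γ K cK)
    (dK : E) (hdK : P.ps.IsCentral dK ∧
      K ∩ (γ '' K) = P.ps.centerIntervalSet dK) :
    ∃ c₁ c₂ c₃ : E,
      (P.ps.IsCentral c₁ ∧ P.ps.IsCentral c₂ ∧ P.ps.IsCentral c₃ ∧
       P.ps.IsMeet c₁ c₂ P.ps.zero ∧ P.ps.IsMeet c₁ c₃ P.ps.zero ∧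
       P.ps.IsMeet c₂ c₃ P.ps.zero ∧
       P.ps.IsSumList [c₁, c₂, c₃] P.ps.one ∧
       c₁ ∈ K ∧
       (c₂ ∈ γ '' K ∧ K ∩ P.ps.centerIntervalSet c₂ = {P.ps.zero}) ∧
       K ∩ {x | P.ps.le x c₃} = {P.ps.zero}) ∧
      (∀ d₁ d₂ d₃ : E,
        (P.ps.IsCentral d₁ ∧ P.ps.IsCentral d₂ ∧ P.ps.IsCentral d₃ ∧
         P.ps.IsMeet d₁ d₂ P.ps.zero ∧ P.ps.IsMeet d₁ d₃ P.ps.zero ∧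
         P.ps.IsMeet d₂ d₃ P.ps.zero ∧
         P.ps.IsSumList [d₁, d₂, d₃] P.ps.one ∧
         d₁ ∈ K ∧
         (d₂ ∈ γ '' K ∧ K ∩ P.ps.centerIntervalSet d₂ = {P.ps.zero}) ∧
         K ∩ {x | P.ps.le x d₃} = {P.ps.zero}) →
        d₁ = c₁ ∧ d₂ = c₂ ∧ d₃ = c₃) ∧
      c₁ = dK ∧
      (∃ dK', P.ps.padd dK dK' = some P.ps.one ∧ P.ps.IsMeet cK dK' c₂) ∧
      P.ps.padd cK c₃ = some P.ps.one ∧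
      K ∩ (γ '' K) = P.ps.centerIntervalSet c₁ ∧
      (∃ s, P.ps.padd c₁ c₂ = some s ∧ ∀ k ∈ K, P.ps.le k s) ∧
      (∃ t, P.ps.padd c₂ c₃ = some t ∧
        P.ps.centerIntervalSet t ∩ K = {P.ps.zero}) := by
  obtain ⟨hdK, hKd⟩ := hdK
  obtain ⟨hcK, hγK⟩ := hcK
  obtain ⟨p, q, hp, rfl⟩ := P.exists_splitting_of_isCentral hdK
  obtain ⟨u, v, hu, rfl⟩ := P.exists_splitting_of_isCentral hcK
  have hd : p P.one ∈ K ∩ γ '' K := hKd ▸ ⟨hdK, P.le_refl _⟩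
  have hdc : P.ps.le (p P.one) (u P.one) := by
    have h := hd.2
    rw [hγK] at h
    exact h.2
  have meet_mem : ∀ {k c m}, k ∈ K → P.ps.IsCentral c → P.ps.IsMeet k c m → m ∈ K :=
    fun hk hc hm => hK.2 ▸ ⟨_, hk, _, hc, hm⟩
  have le_d : ∀ {x}, x ∈ K → P.ps.IsCentral x → P.ps.le x (p P.one) := fun {x} hx hxc => by
    have h : x ∈ K ∩ γ '' K := ⟨hx, x, hx, P.centralCover_eq_self hγ hxc⟩
    rw [hKd] at h
    exact h.2
  have le_c : ∀ {k}, k ∈ K → P.ps.le k (u P.one) := fun {k} hk => by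
    have h : γ k ∈ γ '' K := ⟨k, hk, rfl⟩
    rw [hγK] at h
    exact P.le_trans (hγ k).2.1 h.2
  have hzc : P.ps.IsCentral P.zero := P.splitting_zero_id.isCentral
  have hzK : P.zero ∈ K := meet_mem hd.1 hzc
    ⟨P.zero_le _, P.le_refl _, fun _ _ h => h⟩
  have hpu : p (u P.one) = p P.one := by
    refine P.le_antisymm (hp.mono ⟨_, hu.sum _⟩) ?_
    have h := hp.mono hdc
    rwa [hp.idem] at h
  have hsum : P.padd (p P.one) (q (u P.one)) = some (u P.one) := hpu ▸ hp.sum (u P.one)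
  have hc₂ : P.ps.IsCentral (q (u P.one)) := by
    obtain ⟨r, hr⟩ := hp.swap.exists_comp hu
    exact hr.isCentral
  have hc₂c : P.ps.le (q (u P.one)) (u P.one) := hp.swap.map_le _
  refine ⟨p P.one, q (u P.one), v P.one, ⟨hdK, hc₂, hu.swap.isCentral,
    hp.isMeet_zero (P.le_refl _) (P.le_refl _), hu.isMeet_zero hdc (P.le_refl _),
    hu.isMeet_zero hc₂c (P.le_refl _), ⟨_, hsum, _, hu.sum _, rfl⟩, hd.1,
    ⟨hγK ▸ ⟨hc₂, hc₂c⟩, ?_⟩, ?_⟩, ?_, rfl, ⟨q P.one, hp.sum _, hp.swap.isMeet _⟩, hu.sum _,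
    hKd, ⟨_, hsum, fun k hk => le_c hk⟩, q P.one, ?_, ?_⟩
  · refine Set.eq_singleton_iff_unique_mem.mpr ⟨⟨hzK, hzc, P.zero_le _⟩, ?_⟩
    rintro x ⟨hxK, hxc, hx⟩
    exact hp.eq_zero_of_le_of_le (le_d hxK hxc) hx
  · refine Set.eq_singleton_iff_unique_mem.mpr ⟨⟨hzK, P.zero_le _⟩, ?_⟩
    rintro x ⟨hxK, hx⟩
    exact hu.eq_zero_of_le_of_le (le_c hxK) hx
  · rintro d₁ d₂ d₃ ⟨h₁, h₂, h₃, -, -, -, ⟨t, ht, s, hs, hs1⟩, hd₁, ⟨hd₂, hd₂'⟩, hd₃⟩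
    obtain rfl : P.one = s := hs1
    have pd_zero : ∀ {d}, P.ps.IsCentral d →
        (∀ x ∈ K, P.ps.IsCentral x → P.ps.le x d → x = P.zero) → p d = P.zero := by
      intro d hdc hd0
      refine hd0 _ (meet_mem hd.1 hdc ⟨hp.mono (P.le_one _), hp.map_le _,
        fun x hx hx' => (hp.isMeet d).2.2 x hx' hx⟩) ?_ (hp.map_le _)
      obtain ⟨p₂, q₂, hp₂, rfl⟩ := P.exists_splitting_of_isCentral hdc
      obtain ⟨r, hr⟩ := hp.exists_comp hp₂
      exact hr.isCentral
    have hp₂ : p d₂ = P.zero := pd_zero h₂ fun x hx hxc hxd => by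
      have h : x ∈ K ∩ P.ps.centerIntervalSet d₂ := ⟨hx, hxc, hxd⟩
      rwa [hd₂'] at h
    have hd₃' : ∀ x ∈ K, P.ps.le x d₃ → x = P.zero := fun x hx hxd => by
      have h : x ∈ K ∩ {x | P.ps.le x d₃} := ⟨hx, hxd⟩
      rwa [hd₃] at h
    have hp₃ : p d₃ = P.zero := pd_zero h₃ fun x hx _ hxd => hd₃' x hx hxd
    have e₁ : d₁ = p P.one := by
      have ht' := hp.map_add ht
      have hs' := hp.map_add hs
      rw [hp₂, P.padd_zero] at ht'
      rw [hp₃, P.padd_zero, ← Option.some.inj ht'] at hs'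
      refine P.le_antisymm (le_d hd₁ h₁) ?_
      rw [← Option.some.inj hs']
      exact hp.map_le _
    have hu₃ : u d₃ = P.zero := by
      obtain ⟨p₃, q₃, hs₃, rfl⟩ := P.exists_splitting_of_isCentral h₃
      have huK : u P.one ∈ γ '' K := hγK ▸ ⟨hcK, P.le_refl _⟩
      obtain ⟨k, hk, hkc⟩ := huK
      have hk0 : p₃ k = P.zero := hd₃' _ (meet_mem hk h₃ (hs₃.isMeet k)) (hs₃.isMeet k).2.1
      have hkq : P.ps.le k (q₃ P.one) := by
        have h := hs₃.sum k
        rw [hk0, P.zero_padd] at h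
        rw [← Option.some.inj h]
        exact hs₃.swap.mono (P.le_one _)
      have hcq := (hγ k).2.2 _ hs₃.swap.isCentral hkq
      rw [hkc] at hcq
      exact hs₃.eq_zero_of_le_of_le (hu.map_le _)
        (P.le_trans (hu.mono (P.le_one _)) hcq)
    have hd₂c : P.ps.le d₂ (u P.one) := by
      rw [hγK] at hd₂
      exact hd₂.2
    have et : t = u P.one := by
      have ht' := hu.map_add ht
      have hs' := hu.map_add hs
      rw [hu.map_eq_self_of_le (le_c hd₁), hu.map_eq_self_of_le hd₂c] at ht'
      rw [hu₃, P.padd_zero, ← Option.some.inj (ht.symm.trans ht')] at hs'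
      exact Option.some.inj hs'
    subst e₁ et
    exact ⟨rfl, P.add_left_cancel ht hsum, P.add_left_cancel hs (hu.sum _)⟩
  · obtain ⟨t, ht, ht'⟩ := P.assoc_right hsum (hu.sum _)
    rw [← P.add_left_cancel ht' (hp.sum _)]
    exact ht
  · refine Set.eq_singleton_iff_unique_mem.mpr ⟨⟨⟨hzc, P.zero_le _⟩, hzK⟩, ?_⟩
    rintro x ⟨⟨hxc, hx⟩, hxK⟩
    exact hp.eq_zero_of_le_of_le (le_d hxK hxc) hx
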